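/- Let 1 ≤ p ≤ q with 1/p + 1/q > 1, let T > 0, let ω : [0,T] → ℝ^m be continuous of finite p-variation and y : [0,T] → ℝ^d continuous of finite q-variation. Assume there exist a control function A on Δ[0,T] and a constant a_1 > 0 such that |||y|||_{q-var,[s,t]} ≤ A(s,t)^{1/q} + a_1 ( |y_s| + |||y|||_{q-var,[s,t]} ) · ( (t − s) + |||ω|||_{p-var,[s,t]} ) for all 0 ≤ s < t ≤ T. Then there exists a constant C, depending only on p, q, a_1 (in particular independent of T), such that for all 0 ≤ s < t ≤ T, |||y|||_{q-var,[s,t]} ≤ (2A(s,t)^{1/q} + |y_s|) · exp( C·( |t − s|^p + |||ω|||^p_{p-var,[s,t]} ) ). -/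

import Mathlib

open scoped BigOperators
open Set

noncomputable section

/-- Euclidean space `ℝ^n`. -/
abbrev Ed (n : ℕ) : Type := EuclideanSpace ℝ (Fin n)

section PVarDefs

variable {E F : Type*} [NormedAddCommGroup E] [NormedSpace ℝ E]
  [NormedAddCommGroup F] [NormedSpace ℝ F]

/-- The set of sums `Σ_i ‖x (t (i+1)) - x (t i)‖ ^ p` over all finite partitions
`a = t 0 < t 1 < ⋯ < t n = b` of `[a,b]`. -/
def pVarSums (p : ℝ) (x : ℝ → E) (a b : ℝ) : Set ℝ :=
  { v | ∃ n : ℕ, ∃ t : Fin (n + 1) → ℝ, StrictMono t ∧ t 0 = a ∧ t (Fin.last n) = b ∧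
      v = ∑ i : Fin n, ‖x (t i.succ) - x (t i.castSucc)‖ ^ p }

/-- The `p`-variation seminorm `|||x|||_{p-var,[a,b]}`. -/
def pVar (p : ℝ) (x : ℝ → E) (a b : ℝ) : ℝ :=
  sSup (pVarSums p x a b) ^ (1 / p)

/-- `x` is of finite `p`-variation on `[a,b]`. -/
def FinitePVar (p : ℝ) (x : ℝ → E) (a b : ℝ) : Prop :=
  BddAbove (pVarSums p x a b)

/-- The `p`-variation norm `‖x‖_{p-var,[a,b]} = ‖x a‖ + |||x|||_{p-var,[a,b]}`. -/
def pVarNorm (p : ℝ) (x : ℝ → E) (a b : ℝ) : ℝ :=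
  ‖x a‖ + pVar p x a b

/-- A control function on `[a,b]`: continuous on the simplex, vanishing on the diagonal,
superadditive and nonnegative. -/
def IsControlOn (a b : ℝ) (w : ℝ → ℝ → ℝ) : Prop :=
  ContinuousOn (fun pr : ℝ × ℝ => w pr.1 pr.2) {pr : ℝ × ℝ | a ≤ pr.1 ∧ pr.1 ≤ pr.2 ∧ pr.2 ≤ b} ∧
  (∀ t : ℝ, a ≤ t → t ≤ b → w t t = 0) ∧
  (∀ s t u : ℝ, a ≤ s → s ≤ t → t ≤ u → u ≤ b → w s t + w t u ≤ w s u) ∧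
  (∀ s t : ℝ, a ≤ s → s ≤ t → t ≤ b → 0 ≤ w s t)

/-- A tagged partition `a = t 0 < t 1 < ⋯ < t n = b` of `[a,b]`, with tags
`tag i ∈ [t i, t (i+1)]`. -/
structure TaggedPartition (a b : ℝ) where
  n : ℕ
  t : Fin (n + 1) → ℝ
  tag : Fin n → ℝ
  mono : StrictMono t
  first : t 0 = a
  last : t (Fin.last n) = b
  tag_mem : ∀ i : Fin n, tag i ∈ Set.Icc (t i.castSucc) (t i.succ)

/-- The mesh of a tagged partition. -/
def TaggedPartition.mesh {a b : ℝ} (P : TaggedPartition a b) : ℝ :=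
  ⨆ i : Fin P.n, (P.t i.succ - P.t i.castSucc)

/-- Riemann–Stieltjes sum of `x` against `ω` along a tagged partition. -/
def RSSum (x : ℝ → E →L[ℝ] F) (ω : ℝ → E) {a b : ℝ} (P : TaggedPartition a b) : F :=
  ∑ i : Fin P.n, x (P.tag i) (ω (P.t i.succ) - ω (P.t i.castSucc))

/-- `v` is the Young integral `∫_a^b x dω`: the Riemann–Stieltjes sums converge to `v`
as the mesh tends to `0`. -/
def IsYoungIntegral (x : ℝ → E →L[ℝ] F) (ω : ℝ → E) (a b : ℝ) (v : F) : Prop :=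
  ∀ ε : ℝ, 0 < ε → ∃ δ : ℝ, 0 < δ ∧
    ∀ P : TaggedPartition a b, P.mesh < δ → ‖RSSum x ω P - v‖ < ε

/-- The Young integral `∫_a^b x dω` (an arbitrary value, `0`, if the limit does not exist). -/
def youngIntegral (x : ℝ → E →L[ℝ] F) (ω : ℝ → E) (a b : ℝ) : F :=
  letI := Classical.propDecidable (∃ v, IsYoungIntegral x ω a b v)
  if hv : ∃ v, IsYoungIntegral x ω a b v then hv.choose else 0

end PVarDefs

section PVarLemmas

variable {E : Type*} [NormedAddCommGroup E]

/-- `v` is the `p`-variation sum of `x` along some partition of `[a, b]`; this is the recursive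
form of membership in `pVarSums p x a b`. -/
inductive IsPVarSum (p : ℝ) (x : ℝ → E) (b : ℝ) : ℝ → ℝ → Prop
  | nil : IsPVarSum p x b b 0
  | cons {a c v : ℝ} (hac : a < c) (h : IsPVarSum p x b c v) :
      IsPVarSum p x b a (‖x c - x a‖ ^ p + v)

theorem mem_pVarSums_iff {p : ℝ} {x : ℝ → E} {a b v : ℝ} :
    v ∈ pVarSums p x a b ↔ IsPVarSum p x b a v := by
  constructor
  · rintro ⟨n, t, ht, rfl, rfl, rfl⟩
    induction n with
    | zero => simpa using IsPVarSum.nil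
    | succ n ih =>
      rw [Fin.sum_univ_succ]
      have h := ih (fun i => t i.succ) (ht.comp (Fin.strictMono_succ))
      exact IsPVarSum.cons (ht (by simp)) h
  · intro h
    induction h with
    | nil => exact ⟨0, fun _ => b, Subsingleton.strictMono (α := Fin 1) _, rfl, rfl, by simp⟩
    | @cons a c v hac _ ih =>
      obtain ⟨n, t, ht, rfl, hb, rfl⟩ := ih
      refine ⟨n + 1, Fin.cons a t, ?_, rfl, ?_, ?_⟩
      · refine Fin.strictMono_iff_lt_succ.2 (Fin.cases ?_ fun i => ?_)
        · simpa using hac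
        · simpa using ht i.castSucc_lt_succ
      · rw [← Fin.succ_last, Fin.cons_succ, hb]
      · rw [Fin.sum_univ_succ]
        simp only [Fin.castSucc_zero, Fin.cons_zero, Fin.cons_succ, Fin.castSucc_succ]

namespace IsPVarSum

variable {p : ℝ} {x : ℝ → E} {a b c v w : ℝ}

theorem le (h : IsPVarSum p x b a v) : a ≤ b := by
  induction h with
  | nil => exact le_rfl
  | cons hac _ ih => exact hac.le.trans ih

theorem nonneg (h : IsPVarSum p x b a v) : 0 ≤ v := by
  induction h with
  | nil => exact le_rfl
  | cons hac _ ih => positivity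

theorem eq_zero (h : IsPVarSum p x a a v) : v = 0 := by
  cases h with
  | nil => rfl
  | cons hac h => exact absurd h.le hac.not_ge

theorem exists_cons (h : IsPVarSum p x b a v) (hab : a < b) :
    ∃ c v', a < c ∧ IsPVarSum p x b c v' ∧ v = ‖x c - x a‖ ^ p + v' := by
  cases h with
  | nil => exact absurd hab (lt_irrefl _)
  | cons hac h => exact ⟨_, _, hac, h, rfl⟩

theorem append (h : IsPVarSum p x b a v) (h' : IsPVarSum p x c b w) :
    IsPVarSum p x c a (v + w) := by
  induction h with
  | nil => simpa using h'
  | cons hac _ ih => rw [add_assoc]; exact ih.cons hac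

theorem single (hab : a < b) : IsPVarSum p x b a (‖x b - x a‖ ^ p) := by
  simpa using IsPVarSum.nil.cons (p := p) (x := x) hab

theorem exists_of_le (hab : a ≤ b) : ∃ v, IsPVarSum p x b a v := by
  rcases hab.eq_or_lt with rfl | h
  · exact ⟨0, .nil⟩
  · exact ⟨_, single h⟩

/-- A partition of `[a, b]` has an interval `[c, c']` straddling any given `u ∈ (a, b]`. -/
theorem exists_split (h : IsPVarSum p x b a v) {u : ℝ} (hau : a < u) (hub : u ≤ b) :
    ∃ c c' v₁ v₂, c < u ∧ u ≤ c' ∧ IsPVarSum p x c a v₁ ∧ IsPVarSum p x b c' v₂ ∧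
      v = v₁ + ‖x c' - x c‖ ^ p + v₂ := by
  induction h with
  | nil => exact absurd hub hau.not_ge
  | @cons a e v hae h ih =>
    rcases lt_or_ge e u with heu | hue
    · obtain ⟨c, c', v₁, v₂, hc, hc', h₁, h₂, rfl⟩ := ih heu
      exact ⟨c, c', _, v₂, hc, hc', h₁.cons hae, h₂, by ring⟩
    · exact ⟨a, e, 0, v, hau, hue, .nil, h, by ring⟩

end IsPVarSum

variable {p : ℝ} {x : ℝ → E} {a b c u T : ℝ}

theorem FinitePVar.mono (h : FinitePVar p x 0 T) (ha : 0 ≤ a) (hb : b ≤ T) :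
    FinitePVar p x a b := by
  obtain ⟨M, hM⟩ := h
  refine ⟨M, fun v hv => ?_⟩
  have hv := mem_pVarSums_iff.1 hv
  obtain ⟨v₁, h₁⟩ := IsPVarSum.exists_of_le (p := p) (x := x) ha
  obtain ⟨v₂, h₂⟩ := IsPVarSum.exists_of_le (p := p) (x := x) hb
  have := hM (mem_pVarSums_iff.2 ((h₁.append hv).append h₂))
  linarith [h₁.nonneg, h₂.nonneg]

theorem sSup_pVarSums_nonneg : 0 ≤ sSup (pVarSums p x a b) :=
  Real.sSup_nonneg fun _ hv => (mem_pVarSums_iff.1 hv).nonneg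

theorem IsPVarSum.le_sSup {v : ℝ} (h : IsPVarSum p x b a v) (hf : FinitePVar p x a b) :
    v ≤ sSup (pVarSums p x a b) :=
  le_csSup hf (mem_pVarSums_iff.2 h)

theorem sSup_pVarSums_le (hab : a ≤ b) {M : ℝ} (h : ∀ v, IsPVarSum p x b a v → v ≤ M) :
    sSup (pVarSums p x a b) ≤ M :=
  csSup_le ((IsPVarSum.exists_of_le hab).imp fun _ => mem_pVarSums_iff.2)
    fun v hv => h v (mem_pVarSums_iff.1 hv)

theorem sSup_pVarSums_self : sSup (pVarSums p x a a) = 0 :=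
  le_antisymm (sSup_pVarSums_le le_rfl fun _ h => h.eq_zero.le) sSup_pVarSums_nonneg

theorem pVar_nonneg : 0 ≤ pVar p x a b :=
  Real.rpow_nonneg sSup_pVarSums_nonneg _

theorem pVar_self (hp : 0 < p) : pVar p x a a = 0 := by
  rw [pVar, sSup_pVarSums_self, Real.zero_rpow (one_div_pos.2 hp).ne']

theorem pVar_rpow (hp : 0 < p) : pVar p x a b ^ p = sSup (pVarSums p x a b) := by
  rw [pVar, ← Real.rpow_mul sSup_pVarSums_nonneg, one_div_mul_cancel hp.ne', Real.rpow_one]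

theorem sSup_pVarSums_add_le (hab : a ≤ b) (hbc : b ≤ c) (hf : FinitePVar p x a c) :
    sSup (pVarSums p x a b) + sSup (pVarSums p x b c) ≤ sSup (pVarSums p x a c) := by
  rw [← le_sub_iff_add_le]
  refine sSup_pVarSums_le hab fun v hv => ?_
  rw [le_sub_comm]
  refine sSup_pVarSums_le hbc fun w hw => ?_
  linarith [(hv.append hw).le_sSup hf]

theorem norm_sub_le_pVar (hp : 0 < p) (hab : a ≤ b) (hf : FinitePVar p x a b) :
    ‖x b - x a‖ ≤ pVar p x a b := by
  rcases hab.eq_or_lt with rfl | h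
  · simpa using pVar_nonneg
  · rw [pVar, ← Real.rpow_rpow_inv (norm_nonneg (x b - x a)) hp.ne', one_div]
    exact Real.rpow_le_rpow (by positivity) ((IsPVarSum.single h).le_sSup hf) (by positivity)

theorem rpow_add_rpow_add_le (hp : 1 ≤ p) {r s α β : ℝ} (hr : 0 ≤ r) (hs : 0 ≤ s)
    (hα : 0 ≤ α) (hβ : 0 ≤ β) :
    (r + (α + β) ^ p + s) ^ (1 / p) ≤ (r + α ^ p) ^ (1 / p) + (β ^ p + s) ^ (1 / p) := by
  have hp0 : p ≠ 0 := by positivity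
  have h := Real.Lp_add_le_of_nonneg (s := Finset.univ) (f := ![r ^ p⁻¹, α, 0])
    (g := ![0, β, s ^ p⁻¹]) hp
    (by intro i _; fin_cases i <;> simp <;> positivity)
    (by intro i _; fin_cases i <;> simp <;> positivity)
  simpa [Fin.sum_univ_three, Real.rpow_inv_rpow, Real.zero_rpow, hr, hs, hp0] using h

theorem pVar_le_add (hp : 1 ≤ p) (hau : a ≤ u) (hub : u ≤ b)
    (h₁ : FinitePVar p x a u) (h₂ : FinitePVar p x u b) :
    pVar p x a b ≤ pVar p x a u + pVar p x u b := by
  have hp0 : 0 < p := by positivity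
  rcases hau.eq_or_lt with rfl | hau'
  · linarith [pVar_nonneg (p := p) (x := x) (a := a) (b := a)]
  have hnn : 0 ≤ pVar p x a u + pVar p x u b := add_nonneg pVar_nonneg pVar_nonneg
  rw [pVar, one_div, Real.rpow_inv_le_iff_of_pos sSup_pVarSums_nonneg hnn hp0]
  refine sSup_pVarSums_le (hau.trans hub) fun v hv => ?_
  rw [← Real.rpow_inv_le_iff_of_pos hv.nonneg hnn hp0, ← one_div]
  obtain ⟨c, c', v₁, v₂, hc, hc', hv₁, hv₂, rfl⟩ := hv.exists_split hau' hub
  have hleft : v₁ + ‖x u - x c‖ ^ p ≤ sSup (pVarSums p x a u) :=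
    (hv₁.append (.single hc)).le_sSup h₁
  have hright : ‖x c' - x u‖ ^ p + v₂ ≤ sSup (pVarSums p x u b) := by
    rcases hc'.eq_or_lt with rfl | hc'
    · simpa [Real.zero_rpow hp0.ne'] using hv₂.le_sSup h₂
    · exact (hv₂.cons hc').le_sSup h₂
  have hv₁0 := hv₁.nonneg
  have hv₂0 := hv₂.nonneg
  calc (v₁ + ‖x c' - x c‖ ^ p + v₂) ^ (1 / p)
      ≤ (v₁ + (‖x u - x c‖ + ‖x c' - x u‖) ^ p + v₂) ^ (1 / p) := by
        gcongr
        rw [add_comm]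
        exact norm_sub_le_norm_sub_add_norm_sub _ _ _
    _ ≤ (v₁ + ‖x u - x c‖ ^ p) ^ (1 / p) + (‖x c' - x u‖ ^ p + v₂) ^ (1 / p) :=
        rpow_add_rpow_add_le hp hv₁0 hv₂0 (norm_nonneg _) (norm_nonneg _)
    _ ≤ pVar p x a u + pVar p x u b := by
        unfold pVar
        gcongr

/-- If the control `(t - s) ^ p + |||x|||^p` of `[s, t]` is at most `κ + M`, then `[s, t]` splits
into two intervals on which this control is at most `κ` and `M` respectively. -/
theorem exists_split_pVar_le (hp : 1 ≤ p) {s t κ M : ℝ} (hx : ContinuousOn x (Icc s t))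
    (hst : s ≤ t) (hf : ∀ a b, s ≤ a → b ≤ t → FinitePVar p x a b) (hκ : 0 ≤ κ) (hM : 0 ≤ M)
    (h : (t - s) ^ p + sSup (pVarSums p x s t) ≤ κ + M) :
    ∃ u ∈ Icc s t, (u - s) ^ p + sSup (pVarSums p x s u) ≤ κ ∧
      (t - u) ^ p + sSup (pVarSums p x u t) ≤ M := by
  have hp0 : 0 < p := by positivity
  set S : Set ℝ := {u | u ∈ Icc s t ∧ (u - s) ^ p + sSup (pVarSums p x s u) ≤ κ}
  have hsS : s ∈ S :=
    ⟨left_mem_Icc.2 hst, by simpa [sSup_pVarSums_self, Real.zero_rpow hp0.ne'] using hκ⟩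
  have hbdd : BddAbove S := ⟨t, fun u hu => hu.1.2⟩
  set u := sSup S
  have hsu : s ≤ u := le_csSup hbdd hsS
  have hut : u ≤ t := csSup_le ⟨s, hsS⟩ fun v hv => hv.1.2
  have hSsub : S ⊆ Icc s t := fun v hv => hv.1
  have hxu : ContinuousWithinAt x (Icc s t) u := hx u ⟨hsu, hut⟩
  refine ⟨u, ⟨hsu, hut⟩, ?_, ?_⟩
  · rcases hsu.eq_or_lt with hsu' | hsu'
    · rw [← hsu']; exact hsS.2
    rw [← le_sub_iff_add_le']
    refine sSup_pVarSums_le hsu fun v hv => ?_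
    obtain ⟨c, c', v₁, v₂, hc, hc', hv₁, hv₂, rfl⟩ := hv.exists_split hsu' le_rfl
    obtain rfl : c' = u := le_antisymm hv₂.le hc'
    rw [hv₂.eq_zero, le_sub_iff_add_le']
    have : (nhdsWithin u S).NeBot :=
      mem_closure_iff_nhdsWithin_neBot.1 (csSup_mem_closure ⟨s, hsS⟩ hbdd)
    have hlim : ContinuousWithinAt
        (fun z => (z - s) ^ p + (v₁ + ‖x z - x c‖ ^ p + 0)) S u :=
      ((continuousWithinAt_id.sub continuousWithinAt_const).rpow_const (Or.inr hp0.le)).add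
        ((continuousWithinAt_const.add
          (((hxu.mono hSsub).sub continuousWithinAt_const).norm.rpow_const
            (Or.inr hp0.le))).add continuousWithinAt_const)
    refine le_of_tendsto hlim ?_
    filter_upwards [self_mem_nhdsWithin, nhdsWithin_le_nhds (lt_mem_nhds hc)] with z hz hcz
    have := (hv₁.append (.single hcz)).le_sSup (hf s z le_rfl hz.1.2)
    linarith [hz.2]
  · rcases hut.eq_or_lt with hut' | hut'
    · rw [hut']; simpa [sSup_pVarSums_self, Real.zero_rpow hp0.ne'] using hM
    rw [← le_sub_iff_add_le']
    refine sSup_pVarSums_le hut fun v hv => ?_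
    rw [le_sub_iff_add_le']
    obtain ⟨c, v, hc, hv', rfl⟩ := hv.exists_cons hut'
    have hlim : ContinuousWithinAt
        (fun z => (t - z) ^ p + (‖x c - x z‖ ^ p + v)) (Ioo u t) u :=
      ((continuousWithinAt_const.sub continuousWithinAt_id).rpow_const (Or.inr hp0.le)).add
        (((continuousWithinAt_const.sub (hxu.mono (Ioo_subset_Icc_self.trans
          (Icc_subset_Icc_left hsu)))).norm.rpow_const (Or.inr hp0.le)).add
            continuousWithinAt_const)
    have : (nhdsWithin u (Ioo u t)).NeBot := left_nhdsWithin_Ioo_neBot hut'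
    refine le_of_tendsto hlim ?_
    filter_upwards [self_mem_nhdsWithin, nhdsWithin_le_nhds (gt_mem_nhds hc)] with z hz hzc
    have hsz : s ≤ z := hsu.trans hz.1.le
    have hzS : κ < (z - s) ^ p + sSup (pVarSums p x s z) := by
      by_contra! hle
      exact hz.1.not_ge (le_csSup hbdd ⟨⟨hsz, hz.2.le⟩, hle⟩)
    have hsum := (hv'.cons hzc).le_sSup (hf z t hsz le_rfl)
    have hadd := sSup_pVarSums_add_le hsz hz.2.le (hf s t le_rfl le_rfl)
    have hpow : (z - s) ^ p + (t - z) ^ p ≤ (t - s) ^ p := by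
      have := Real.add_rpow_le_rpow_add (sub_nonneg.2 hsz) (sub_nonneg.2 hz.2.le) hp
      rwa [sub_add_sub_cancel'] at this
    linarith

end PVarLemmas

/-- Corollary `coll6`: if
`|||y|||_{q-var,[s,t]} ≤ A(s,t)^{1/q} + a₁(‖y s‖ + |||y|||_{q-var,[s,t]})((t-s) + |||ω|||_{p-var,[s,t]})`
for a control `A` and a constant `a₁ > 0`, then there is a constant `C` depending only on
`p, q, a₁` (in particular independent of `T`) such that
`|||y|||_{q-var,[s,t]} ≤ (2 A(s,t)^{1/q} + ‖y s‖) exp(C(|t-s|^p + |||ω|||^p_{p-var,[s,t]}))`. -/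
theorem stmt12 {d m : ℕ} (p q a1 : ℝ) (hp : 1 ≤ p) (hpq : p ≤ q)
    (hθ : 1 < 1 / p + 1 / q) (ha1 : 0 < a1) :
    ∃ C : ℝ, ∀ (T : ℝ) (ω : ℝ → Ed m) (y : ℝ → Ed d) (A : ℝ → ℝ → ℝ),
      0 < T → ContinuousOn ω (Set.Icc 0 T) → FinitePVar p ω 0 T →
      ContinuousOn y (Set.Icc 0 T) → FinitePVar q y 0 T →
      IsControlOn 0 T A →
      (∀ s t : ℝ, 0 ≤ s → s < t → t ≤ T →
        pVar q y s t ≤ A s t ^ (1 / q) +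
          a1 * (‖y s‖ + pVar q y s t) * ((t - s) + pVar p ω s t)) →
      ∀ s t : ℝ, 0 ≤ s → s < t → t ≤ T →
        pVar q y s t ≤
          (2 * A s t ^ (1 / q) + ‖y s‖) *
            Real.exp (C * (|t - s| ^ p + pVar p ω s t ^ p)) := by
  have hp0 : 0 < p := by positivity
  have hq : 1 ≤ q := hp.trans hpq
  have hq0 : 0 < q := by positivity
  set κ : ℝ := (1 / (4 * a1)) ^ p
  have hκ0 : 0 < κ := by positivity
  refine ⟨Real.log 4 / κ, fun T ω y A _ hω hωf _ hyf hA hle s t hs hst htT => ?_⟩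
  obtain ⟨-, -, hAadd, hAnn⟩ := hA
  have base : ∀ s t : ℝ, 0 ≤ s → s ≤ t → t ≤ T →
      (t - s) ^ p + sSup (pVarSums p ω s t) ≤ κ →
      pVar q y s t ≤ 2 * A s t ^ (1 / q) + ‖y s‖ := by
    intro s t hs hst htT hw
    have hAst := hAnn s t hs hst htT
    rcases hst.eq_or_lt with rfl | hst
    · rw [pVar_self hq0]; positivity
    have hts : 0 ≤ t - s := sub_nonneg.2 hst.le
    have hV : 0 ≤ sSup (pVarSums p ω s t) := sSup_pVarSums_nonneg
    have hlen : t - s ≤ 1 / (4 * a1) :=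
      (Real.rpow_le_rpow_iff hts (by positivity) hp0).1 (by linarith)
    have hvar : pVar p ω s t ≤ 1 / (4 * a1) := by
      refine (Real.rpow_le_rpow_iff pVar_nonneg (by positivity) hp0).1 ?_
      rw [pVar_rpow hp0]
      linarith [Real.rpow_nonneg hts p]
    have hsmall : a1 * ((t - s) + pVar p ω s t) ≤ 1 / 2 := by
      calc a1 * ((t - s) + pVar p ω s t) ≤ a1 * (1 / (4 * a1) + 1 / (4 * a1)) := by gcongr
        _ = 1 / 2 := by field_simp; norm_num
    have hyn : 0 ≤ ‖y s‖ + pVar q y s t := add_nonneg (norm_nonneg _) pVar_nonneg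
    have := hle s t hs hst htT
    have := mul_le_mul_of_nonneg_left hsmall hyn
    linarith
  have key : ∀ n : ℕ, ∀ s t : ℝ, 0 ≤ s → s ≤ t → t ≤ T →
      (t - s) ^ p + sSup (pVarSums p ω s t) ≤ (n + 1) * κ →
      pVar q y s t ≤ (2 * A s t ^ (1 / q) + ‖y s‖) * 4 ^ n := by
    intro n
    induction n with
    | zero => simpa using base
    | succ n ih =>
      intro s t hs hst htT hw
      obtain ⟨u, ⟨hsu, hut⟩, hw₁, hw₂⟩ := exists_split_pVar_le (M := (n + 1) * κ) hp
        (hω.mono (Icc_subset_Icc hs htT)) hst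
        (fun a b ha hb => hωf.mono (hs.trans ha) (hb.trans htT)) hκ0.le (by positivity)
        (by push_cast at hw; linarith)
      have hAst := hAnn s t hs hst htT
      have hAsu := hAnn s u hs hsu (hut.trans htT)
      have hAut := hAnn u t (hs.trans hsu) hut htT
      have hadd := hAadd s u t hs hsu hut htT
      have hA₁ : A s u ^ (1 / q) ≤ A s t ^ (1 / q) := by gcongr; linarith
      have hA₂ : A u t ^ (1 / q) ≤ A s t ^ (1 / q) := by gcongr; linarith
      have hfsu : FinitePVar q y s u := hyf.mono hs (hut.trans htT)
      have hfut : FinitePVar q y u t := hyf.mono (hs.trans hsu) htT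
      have h₁ := base s u hs hsu (hut.trans htT) hw₁
      have h₂ := ih u t (hs.trans hsu) hut htT hw₂
      have hyu : ‖y u‖ ≤ ‖y s‖ + pVar q y s u :=
        (norm_le_norm_add_norm_sub' _ _).trans
          (add_le_add_right (norm_sub_le_pVar hq0 hsu hfsu) _)
      have h4 : (1 : ℝ) ≤ 4 ^ n := one_le_pow₀ (by norm_num)
      have hys := norm_nonneg (y s)
      have hAq : 0 ≤ A s t ^ (1 / q) := by positivity
      calc pVar q y s t ≤ pVar q y s u + pVar q y u t := pVar_le_add hq hsu hut hfsu hfut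
        _ ≤ (2 * A s t ^ (1 / q) + ‖y s‖) * 1 +
            (3 * (2 * A s t ^ (1 / q) + ‖y s‖)) * 4 ^ n := by
          refine add_le_add (by linarith) (h₂.trans ?_)
          gcongr
          linarith
        _ ≤ (2 * A s t ^ (1 / q) + ‖y s‖) * 4 ^ n +
            (3 * (2 * A s t ^ (1 / q) + ‖y s‖)) * 4 ^ n := by gcongr
        _ = (2 * A s t ^ (1 / q) + ‖y s‖) * 4 ^ (n + 1) := by ring
  have hw0 : 0 ≤ (t - s) ^ p + sSup (pVarSums p ω s t) :=
    add_nonneg (Real.rpow_nonneg (sub_nonneg.2 hst.le) _) sSup_pVarSums_nonneg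
  rw [pVar_rpow hp0, abs_of_pos (sub_pos.2 hst)]
  set w := (t - s) ^ p + sSup (pVarSums p ω s t)
  have hfloor : w ≤ (⌊w / κ⌋₊ + 1) * κ := by
    rw [← div_le_iff₀ hκ0]; exact (Nat.lt_floor_add_one _).le
  have hpos : 0 ≤ A s t := hAnn s t hs hst.le htT
  refine (key _ s t hs hst.le htT hfloor).trans ?_
  gcongr
  rw [← Real.rpow_natCast, Real.rpow_def_of_pos four_pos, div_mul_eq_mul_div, mul_div_assoc]
  have hlog : 0 ≤ Real.log 4 := Real.log_nonneg (by norm_num)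
  exact Real.exp_le_exp.2 (mul_le_mul_of_nonneg_left (Nat.floor_le (by positivity)) hlog)
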